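/- arXiv:1103.1034 — 2 statements merged into one kernel-verified Lean document; each statement's English description precedes it below -/
import Mathlib

section
/- Let f belong to CC^{1,α}_Δ[−1,1] with constants K₁ and 0 < α ≤ 1. Then for every x ∈ (−1,1) the Cauchy principal value R_N(f,x) = J(f − S_N, x) exists and satisfies |R_N(f,x)| ≤ (γ^{1+α}K₁/π)·(1 + 12π/(γ·ln N))·(ln N)/N^{1+α}. -/
open Real MeasureTheory Filter Topology

/-- The error of linear interpolation at the end points of `[a, b]`, when the derivative `g` has
oscillation at most `C`. -/
theorem abs_sub_linear_interpolation_le {f g : ℝ → ℝ} {a b C u : ℝ} (hab : a < b)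
    (hf : ∀ v ∈ Set.Icc a b, HasDerivWithinAt f (g v) (Set.Icc a b) v)
    (hg : ∀ v ∈ Set.Icc a b, ∀ w ∈ Set.Icc a b, |g v - g w| ≤ C) (hu : u ∈ Set.Icc a b) :
    |f u - ((b - u) * f a + (u - a) * f b) / (b - a)| ≤ C * (b - a) / 4 := by
  have hC : 0 ≤ C := (abs_nonneg _).trans (hg u hu u hu)
  have hmvt : ∀ v ∈ Set.Icc a b, ∀ w ∈ Set.Icc a b, v ≤ w →
      ∃ c ∈ Set.Icc a b, f w - f v = g c * (w - v) := by
    intro v hv w hw hvw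
    rcases hvw.eq_or_lt with rfl | hlt
    · exact ⟨v, hv, by simp⟩
    have hsub : Set.Icc v w ⊆ Set.Icc a b := Set.Icc_subset_Icc hv.1 hw.2
    obtain ⟨c, hc, hc'⟩ := exists_hasDerivAt_eq_slope f g hlt
      (fun y hy => ((hf y (hsub hy)).continuousWithinAt).mono hsub)
      (fun y hy => (hf y (hsub (Set.Ioo_subset_Icc_self hy))).hasDerivAt
        (Icc_mem_nhds (hv.1.trans_lt hy.1) (hy.2.trans_le hw.2)))
    refine ⟨c, hsub (Set.Ioo_subset_Icc_self hc), ?_⟩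
    rw [hc', div_mul_cancel₀ _ (sub_pos.2 hlt).ne']
  obtain ⟨c, hc, hfc⟩ := hmvt a (Set.left_mem_Icc.2 hab.le) u hu hu.1
  obtain ⟨d, hd, hfd⟩ := hmvt u hu b (Set.right_mem_Icc.2 hab.le) hu.2
  have hba : 0 < b - a := sub_pos.2 hab
  have h1 : f u - ((b - u) * f a + (u - a) * f b) / (b - a) =
      (b - u) * (u - a) / (b - a) * (g c - g d) := by
    field_simp
    linear_combination (b - u) * hfc - (u - a) * hfd
  have h2 : 0 ≤ (b - u) * (u - a) / (b - a) :=
    div_nonneg (mul_nonneg (sub_nonneg.2 hu.2) (sub_nonneg.2 hu.1)) hba.le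
  have h3 : (b - u) * (u - a) / (b - a) ≤ (b - a) / 4 := by
    rw [div_le_iff₀ hba]
    nlinarith [sq_nonneg (b + a - 2 * u)]
  rw [h1, abs_mul, abs_of_nonneg h2]
  calc _ ≤ (b - a) / 4 * C := mul_le_mul h3 (hg c hc d hd) (abs_nonneg _) (by linarith)
    _ = _ := by ring

/-- The error of linear interpolation at the end points of `[a, b]` is Lipschitz, when the
derivative `g` has oscillation at most `C`. -/
theorem abs_sub_linear_interpolation_sub_le {f g : ℝ → ℝ} {a b C u v : ℝ} (hab : a < b)
    (hf : ∀ v ∈ Set.Icc a b, HasDerivWithinAt f (g v) (Set.Icc a b) v)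
    (hg : ∀ v ∈ Set.Icc a b, ∀ w ∈ Set.Icc a b, |g v - g w| ≤ C)
    (hu : u ∈ Set.Icc a b) (hv : v ∈ Set.Icc a b) :
    |(f u - ((b - u) * f a + (u - a) * f b) / (b - a)) -
      (f v - ((b - v) * f a + (v - a) * f b) / (b - a))| ≤ C * |u - v| := by
  have hba : 0 < b - a := sub_pos.2 hab
  obtain ⟨c, hc, hc'⟩ := exists_hasDerivAt_eq_slope f g hab
    (fun y hy => (hf y hy).continuousWithinAt)
    (fun y hy => (hf y (Set.Ioo_subset_Icc_self hy)).hasDerivAt (Icc_mem_nhds hy.1 hy.2))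
  have key := (convex_Icc a b).norm_image_sub_le_of_norm_hasDerivWithin_le
    (f := fun y => f y - g c * y) (f' := fun y => g y - g c) (C := C)
    (fun y hy => (hf y hy).sub (by simpa using (hasDerivWithinAt_id y _).const_mul (g c)))
    (fun y hy => hg y hy c (Set.Ioo_subset_Icc_self hc)) hv hu
  rw [Real.norm_eq_abs, Real.norm_eq_abs] at key
  convert key using 2
  rw [hc']
  field_simp
  ring

/-- Lipschitz bounds on consecutive intervals glue together. -/
theorem abs_sub_le_of_abs_sub_le_on_grid {e : ℝ → ℝ} {t : ℕ → ℝ} {N : ℕ} {L : ℝ}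
    (hmono : ∀ k, k < N → t k < t (k + 1))
    (he : ∀ k, k < N → ∀ u ∈ Set.Icc (t k) (t (k + 1)), ∀ v ∈ Set.Icc (t k) (t (k + 1)),
      |e u - e v| ≤ L * |u - v|) :
    ∀ u ∈ Set.Icc (t 0) (t N), ∀ v ∈ Set.Icc (t 0) (t N), |e u - e v| ≤ L * |u - v| := by
  have main : ∀ n ≤ N, t 0 ≤ t n ∧
      ∀ u v, t 0 ≤ u → u ≤ v → v ≤ t n → |e u - e v| ≤ L * (v - u) := by
    intro n
    induction n with
    | zero =>
      refine fun _ => ⟨le_rfl, fun u v h1 h2 h3 => ?_⟩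
      have : u = v := le_antisymm h2 (h3.trans h1)
      simp [this]
    | succ n ih =>
      intro hn
      obtain ⟨h0, h⟩ := ih (by omega)
      have hlt := hmono n (by omega)
      have hloc : ∀ u v, t n ≤ u → u ≤ v → v ≤ t (n + 1) → |e u - e v| ≤ L * (v - u) := by
        intro u v h1 h2 h3
        have := he n (by omega) u ⟨h1, h2.trans h3⟩ v ⟨h1.trans h2, h3⟩
        rwa [abs_sub_comm u v, abs_of_nonneg (sub_nonneg.2 h2)] at this
      refine ⟨h0.trans hlt.le, fun u v h1 h2 h3 => ?_⟩
      rcases le_total v (t n) with hv | hv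
      · exact h u v h1 h2 hv
      rcases le_total u (t n) with hu | hu
      · have a1 := h u (t n) h1 hu le_rfl
        have a2 := hloc (t n) v le_rfl hv h3
        calc |e u - e v| ≤ |e u - e (t n)| + |e (t n) - e v| := abs_sub_le _ _ _
          _ ≤ L * (v - u) := by linarith
      · exact hloc u v hu h2 h3
  intro u hu v hv
  rcases le_total u v with h | h
  · rw [abs_sub_comm u v, abs_of_nonneg (sub_nonneg.2 h)]
    exact (main N le_rfl).2 u v hu.1 h hv.2
  · rw [abs_sub_comm (e u), abs_of_nonneg (sub_nonneg.2 h)]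
    exact (main N le_rfl).2 v u hv.1 h hu.2

theorem exists_mem_Icc_grid {t : ℕ → ℝ} {N : ℕ} (hN : 0 < N) {u : ℝ}
    (hu : u ∈ Set.Icc (t 0) (t N)) : ∃ k < N, u ∈ Set.Icc (t k) (t (k + 1)) := by
  induction N with
  | zero => omega
  | succ n ih =>
    rcases le_total (t n) u with h | h
    · exact ⟨n, by omega, h, hu.2⟩
    rcases Nat.eq_zero_or_pos n with rfl | hn
    · exact ⟨0, by omega, hu⟩
    · obtain ⟨k, hk, hk'⟩ := ih hn ⟨hu.1, h⟩
      exact ⟨k, by omega, hk'⟩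

/-- A cut point to the left of `x`, within angle `π / N` of it, at which the antiderivative
`cauchyPrimitive x` below is controlled by `log N`. -/
theorem exists_cut_left {N : ℕ} (hN : 1 ≤ N) {x : ℝ} (hx : x ∈ Set.Ioo (-1 : ℝ) 1) :
    ∃ a, -1 ≤ a ∧ a < x ∧ 1 - x * a + √(1 - x ^ 2) * √(1 - a ^ 2) ≤ N * (x - a) ∧
      arcsin x - arcsin a ≤ π / N := by
  have hN1 : (1 : ℝ) ≤ N := by exact_mod_cast hN
  have hN0 : (0 : ℝ) < N := by linarith
  have hη : 0 < π / N := div_pos pi_pos hN0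
  set η := π / N with hηd
  rcases le_or_gt (arccos x + η) π with h | h
  · have hφ : 0 < arccos x := arccos_pos.2 hx.2
    have hcx : cos (arccos x) = x := cos_arccos hx.1.le hx.2.le
    have hsx : √(1 - x ^ 2) = sin (arccos x) := (sin_arccos x).symm
    refine ⟨cos (arccos x + η), neg_one_le_cos _, ?_, ?_, ?_⟩
    · calc cos (arccos x + η) < cos (arccos x) :=
            cos_lt_cos_of_nonneg_of_le_pi hφ.le h (by linarith)
        _ = x := hcx
    · rw [hsx, ← sin_sq, sqrt_sq (sin_nonneg_of_nonneg_of_le_pi (by linarith) h)]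
      set φ := arccos x
      have e1 : 1 - cos φ * cos (φ + η) + sin φ * sin (φ + η) = 2 * sin (φ + η / 2) ^ 2 := by
        have h1 := cos_add φ (φ + η)
        have h2 := cos_two_mul (φ + η / 2)
        have h3 := sin_sq_add_cos_sq (φ + η / 2)
        rw [show 2 * (φ + η / 2) = φ + (φ + η) by ring] at h2
        linarith
      have e2 : cos φ - cos (φ + η) = 2 * sin (φ + η / 2) * sin (η / 2) := by
        rw [two_mul_sin_mul_sin]
        congr 2 <;> ring
      have hs : 0 ≤ sin (φ + η / 2) :=
        sin_nonneg_of_nonneg_of_le_pi (by linarith) (by linarith)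
      have hj : 1 ≤ N * sin (η / 2) := by
        have := mul_le_sin (x := η / 2) (by linarith) (by linarith)
        have h4 : 2 / π * (η / 2) = 1 / N := by
          rw [hηd]
          field_simp
        rw [h4, div_le_iff₀ hN0] at this
        linarith
      rw [hcx] at e1 e2
      rw [e1, e2]
      nlinarith [sin_le_one (φ + η / 2), mul_nonneg hs (sub_nonneg.2 hj)]
    · rw [arcsin_eq_pi_div_two_sub_arccos, arcsin_eq_pi_div_two_sub_arccos,
        arccos_cos (by linarith) h]
      linarith
  · refine ⟨-1, le_rfl, hx.1, ?_, ?_⟩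
    · norm_num
      nlinarith [hx.1]
    · rw [arcsin_neg_one, arcsin_eq_pi_div_two_sub_arccos]
      linarith

theorem exists_cut_right {N : ℕ} (hN : 1 ≤ N) {x : ℝ} (hx : x ∈ Set.Ioo (-1 : ℝ) 1) :
    ∃ b, x < b ∧ b ≤ 1 ∧ 1 - x * b + √(1 - x ^ 2) * √(1 - b ^ 2) ≤ N * (b - x) ∧
      arcsin b - arcsin x ≤ π / N := by
  obtain ⟨a, h1, h2, h3, h4⟩ :=
    exists_cut_left hN (x := -x) ⟨by linarith [hx.2], by linarith [hx.1]⟩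
  refine ⟨-a, by linarith, by linarith, ?_, ?_⟩
  · rw [neg_sq] at h3 ⊢
    linarith
  · rw [arcsin_neg] at h4 ⊢
    linarith

theorem intervalIntegrable_inv_sqrt_one_sub_sq :
    IntervalIntegrable (fun u : ℝ => 1 / √(1 - u ^ 2)) volume (-1) 1 := by
  refine intervalIntegral.intervalIntegrable_deriv_of_nonneg (g := arcsin)
    continuous_arcsin.continuousOn (fun u hu => ?_) (fun u _ => by positivity)
  rw [min_eq_left (by norm_num), max_eq_right (by norm_num)] at hu
  exact hasDerivAt_arcsin hu.1.ne' hu.2.ne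

/-- An antiderivative of `u ↦ √(1 - x ^ 2) / (√(1 - u ^ 2) * (u - x))`. -/
noncomputable def cauchyPrimitive (x u : ℝ) : ℝ :=
  log (u - x) - log (1 - x * u + √(1 - x ^ 2) * √(1 - u ^ 2))

theorem cauchyPrimitive_arg_pos {x u : ℝ} (hx : x ∈ Set.Ioo (-1 : ℝ) 1)
    (hu : u ∈ Set.Icc (-1 : ℝ) 1) : 0 < 1 - x * u + √(1 - x ^ 2) * √(1 - u ^ 2) := by
  have : 0 < 1 - x * u := by
    have h1 : 0 ≤ (1 - x) * (1 + u) := mul_nonneg (by linarith [hx.2]) (by linarith [hu.1])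
    have h2 : 0 ≤ (1 + x) * (1 - u) := mul_nonneg (by linarith [hx.1]) (by linarith [hu.2])
    rcases le_total 0 u with h | h
    · have : 0 < (1 - x) * (1 + u) := mul_pos (by linarith [hx.2]) (by linarith)
      linarith
    · have : 0 < (1 + x) * (1 - u) := mul_pos (by linarith [hx.1]) (by linarith)
      linarith
  positivity

theorem cauchyPrimitive_neg_one {x : ℝ} : cauchyPrimitive x (-1) = 0 := by
  rw [cauchyPrimitive, ← log_neg_eq_log (-1 - x)]
  norm_num [add_comm]

theorem cauchyPrimitive_one {x : ℝ} : cauchyPrimitive x 1 = 0 := by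
  rw [cauchyPrimitive]
  norm_num

theorem hasDerivAt_cauchyPrimitive {x u : ℝ} (hx : x ∈ Set.Ioo (-1 : ℝ) 1)
    (hu : u ∈ Set.Ioo (-1 : ℝ) 1) (hux : u ≠ x) :
    HasDerivAt (cauchyPrimitive x) (√(1 - x ^ 2) * (1 / (√(1 - u ^ 2) * (u - x)))) u := by
  have hw2 : 0 < 1 - u ^ 2 := by nlinarith [hu.1, hu.2]
  have hs2 : 0 < 1 - x ^ 2 := by nlinarith [hx.1, hx.2]
  have hD := cauchyPrimitive_arg_pos hx (Set.Ioo_subset_Icc_self hu)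
  have hux' : u - x ≠ 0 := sub_ne_zero.2 hux
  have d1 : HasDerivAt (fun u : ℝ => √(1 - u ^ 2)) (-(2 * u) / (2 * √(1 - u ^ 2))) u := by
    refine HasDerivAt.sqrt ?_ hw2.ne'
    simpa using (hasDerivAt_pow 2 u).const_sub 1
  have d2 := (((hasDerivAt_id u).const_mul x).const_sub 1).add (d1.const_mul √(1 - x ^ 2))
  have d3 := ((hasDerivAt_id u).sub_const x).log hux'
  refine (d3.sub (d2.log hD.ne')).congr_deriv ?_
  have hw : 0 < √(1 - u ^ 2) := sqrt_pos.2 hw2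
  have hwsq := sq_sqrt hw2.le
  have hssq := sq_sqrt hs2.le
  simp only [id, mul_one, Pi.add_apply]
  set w := √(1 - u ^ 2)
  set s := √(1 - x ^ 2)
  obtain ⟨D, hDe⟩ : ∃ D, D = 1 - x * u + s * w := ⟨_, rfl⟩
  rw [← hDe] at hD ⊢
  field_simp
  rw [hDe]
  linear_combination s * hwsq - w * hssq

theorem continuousAt_cauchyPrimitive_arg {x : ℝ} (u : ℝ) :
    ContinuousAt (fun u => 1 - x * u + √(1 - x ^ 2) * √(1 - u ^ 2)) u := by
  fun_prop

theorem continuousOn_cauchyPrimitive {x : ℝ} (hx : x ∈ Set.Ioo (-1 : ℝ) 1) :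
    ContinuousOn (cauchyPrimitive x) (Set.Icc (-1) 1 \ {x}) := by
  intro u hu
  refine ContinuousAt.continuousWithinAt ?_
  refine ContinuousAt.sub ?_ ?_
  · exact ContinuousAt.log (by fun_prop) (sub_ne_zero.2 hu.2)
  · exact (continuousAt_cauchyPrimitive_arg u).log (cauchyPrimitive_arg_pos hx hu.1).ne'

theorem intervalIntegrable_of_abs_le_inv_sqrt {h : ℝ → ℝ} {C a b : ℝ} (ha : -1 ≤ a)
    (hab : a ≤ b) (hb : b ≤ 1) (hm : AEStronglyMeasurable h (volume.restrict (Set.Icc (-1) 1)))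
    (hC : ∀ u ∈ Set.Icc a b, |h u| ≤ C * (1 / √(1 - u ^ 2))) :
    IntervalIntegrable h volume a b := by
  have hsub : Set.uIcc a b ⊆ Set.uIcc (-1) 1 := by
    rw [Set.uIcc_of_le hab, Set.uIcc_of_le (by norm_num)]
    exact Set.Icc_subset_Icc ha hb
  refine ((intervalIntegrable_inv_sqrt_one_sub_sq.mono_set hsub).const_mul C).mono_fun' ?_ ?_
  · refine hm.mono_measure (Measure.restrict_mono ?_ le_rfl)
    rw [Set.uIoc_of_le hab]
    exact fun u hu => ⟨ha.trans hu.1.le, hu.2.trans hb⟩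
  · rw [Set.uIoc_of_le hab]
    exact (ae_restrict_mem measurableSet_Ioc).mono
      fun u hu => hC u (Set.Ioc_subset_Icc_self hu)

theorem intervalIntegrable_cauchyKernel {x a b : ℝ} (ha : -1 ≤ a) (hab : a ≤ b) (hb : b ≤ 1)
    (hx : x ∉ Set.Icc a b) :
    IntervalIntegrable (fun u => 1 / (√(1 - u ^ 2) * (u - x))) volume a b := by
  have hd : ∃ d > 0, ∀ u ∈ Set.Icc a b, d ≤ |u - x| := by
    rcases lt_or_ge x a with h | h
    · refine ⟨a - x, by linarith, fun u hu => ?_⟩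
      exact le_trans (by linarith [hu.1]) (le_abs_self _)
    · have hbx : b < x := not_le.1 fun h' => hx ⟨h, h'⟩
      refine ⟨x - b, by linarith, fun u hu => ?_⟩
      exact le_trans (by linarith [hu.2]) (neg_le_abs _)
  obtain ⟨d, hd0, hd⟩ := hd
  refine intervalIntegrable_of_abs_le_inv_sqrt (C := 1 / d) ha hab hb
    (Measurable.aestronglyMeasurable (by fun_prop)) fun u hu => ?_
  rw [abs_div, abs_mul, abs_one, abs_of_nonneg (sqrt_nonneg _), mul_comm (√_), ← one_div_mul_one_div]
  exact mul_le_mul_of_nonneg_right (one_div_le_one_div_of_le hd0 (hd u hu)) (by positivity)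

theorem integral_cauchyKernel {x a b : ℝ} (hx : x ∈ Set.Ioo (-1 : ℝ) 1) (ha : -1 ≤ a)
    (hab : a ≤ b) (hb : b ≤ 1) (hxab : x ∉ Set.Icc a b) :
    √(1 - x ^ 2) * ∫ u in a..b, 1 / (√(1 - u ^ 2) * (u - x)) =
      cauchyPrimitive x b - cauchyPrimitive x a := by
  rw [← intervalIntegral.integral_const_mul]
  refine intervalIntegral.integral_eq_sub_of_hasDerivAt_of_le hab ?_ (fun u hu => ?_)
    ((intervalIntegrable_cauchyKernel ha hab hb hxab).const_mul _)
  · refine (continuousOn_cauchyPrimitive hx).mono fun u hu => ⟨⟨ha.trans hu.1, hu.2.trans hb⟩, ?_⟩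
    rintro rfl
    exact hxab hu
  · refine hasDerivAt_cauchyPrimitive hx ⟨ha.trans_lt hu.1, hu.2.trans_le hb⟩ ?_
    rintro rfl
    exact hxab (Set.Ioo_subset_Icc_self hu)

theorem neg_cauchyPrimitive_le {x u c : ℝ} (hx : x ∈ Set.Ioo (-1 : ℝ) 1)
    (hu : u ∈ Set.Icc (-1 : ℝ) 1) (hux : u ≠ x)
    (h : 1 - x * u + √(1 - x ^ 2) * √(1 - u ^ 2) ≤ c * |u - x|) :
    -cauchyPrimitive x u ≤ log c := by
  have hD := cauchyPrimitive_arg_pos hx hu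
  have hd : 0 < |u - x| := abs_pos.2 (sub_ne_zero.2 hux)
  have hc : 0 < c := pos_of_mul_pos_left (hD.trans_le h) hd.le
  have := log_le_log hD h
  rw [log_mul hc.ne' hd.ne', log_abs] at this
  rw [cauchyPrimitive]
  linarith

theorem tendsto_cauchyPrimitive_sub {x : ℝ} (hx : x ∈ Set.Ioo (-1 : ℝ) 1) :
    Tendsto (fun ε => cauchyPrimitive x (x - ε) - cauchyPrimitive x (x + ε)) (𝓝 0) (𝓝 0) := by
  have hD := cauchyPrimitive_arg_pos hx (Set.Ioo_subset_Icc_self hx)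
  have hc : ContinuousAt
      (fun ε : ℝ => log (1 - x * (x + ε) + √(1 - x ^ 2) * √(1 - (x + ε) ^ 2)) -
        log (1 - x * (x - ε) + √(1 - x ^ 2) * √(1 - (x - ε) ^ 2))) 0 := by
    refine ContinuousAt.sub (ContinuousAt.log (by fun_prop) ?_) (ContinuousAt.log (by fun_prop) ?_)
    · simpa using hD.ne'
    · simpa using hD.ne'
  have := hc.tendsto
  simp only [add_zero, sub_zero, sub_self] at this
  refine this.congr fun ε => ?_
  simp only [cauchyPrimitive, add_sub_cancel_left, sub_sub_cancel_left, log_neg_eq_log]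
  ring

section PrincipalValue

variable {e : ℝ → ℝ} {x L M : ℝ}

theorem aestronglyMeasurable_diffQuot
    (hL : ∀ u ∈ Set.Icc (-1 : ℝ) 1, ∀ v ∈ Set.Icc (-1 : ℝ) 1, |e u - e v| ≤ L * |u - v|) :
    AEStronglyMeasurable (fun u => (e u - e x) / (√(1 - u ^ 2) * (u - x)))
      (volume.restrict (Set.Icc (-1) 1)) := by
  have hL0 : 0 ≤ L := by
    have := (abs_nonneg _).trans (hL 1 (by norm_num) 0 (by norm_num))
    simpa using this
  have hc : ContinuousOn e (Set.Icc (-1) 1) := by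
    refine (LipschitzOnWith.of_dist_le_mul (K := ⟨L, hL0⟩) fun u hu v hv => ?_).continuousOn
    rw [Real.dist_eq, Real.dist_eq]
    exact hL u hu v hv
  exact ((hc.sub continuousOn_const).aestronglyMeasurable measurableSet_Icc).div₀
    (Measurable.aestronglyMeasurable (by fun_prop))

theorem abs_diffQuot_le_of_lipschitz (hx : x ∈ Set.Icc (-1 : ℝ) 1)
    (hL : ∀ u ∈ Set.Icc (-1 : ℝ) 1, ∀ v ∈ Set.Icc (-1 : ℝ) 1, |e u - e v| ≤ L * |u - v|)
    {u : ℝ} (hu : u ∈ Set.Icc (-1 : ℝ) 1) :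
    |(e u - e x) / (√(1 - u ^ 2) * (u - x))| ≤ L * (1 / √(1 - u ^ 2)) := by
  have hL0 : 0 ≤ L := by
    have := (abs_nonneg _).trans (hL 1 (by norm_num) 0 (by norm_num))
    simpa using this
  rcases eq_or_ne u x with rfl | hux
  · simp only [sub_self, zero_div, abs_zero]
    positivity
  have hd : 0 < |u - x| := abs_pos.2 (sub_ne_zero.2 hux)
  rw [abs_div, abs_mul, abs_of_nonneg (sqrt_nonneg _), mul_comm (√_), ← div_div, div_eq_mul_one_div]
  refine mul_le_mul_of_nonneg_right ?_ (by positivity)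
  rw [div_le_iff₀ hd]
  exact hL u hu x hx

theorem abs_diffQuot_le_of_bound (hx : x ∈ Set.Icc (-1 : ℝ) 1)
    (hM : ∀ u ∈ Set.Icc (-1 : ℝ) 1, |e u| ≤ M) {u : ℝ} (hu : u ∈ Set.Icc (-1 : ℝ) 1) :
    |(e u - e x) / (√(1 - u ^ 2) * (u - x))| ≤ 2 * M * (1 / (√(1 - u ^ 2) * |u - x|)) := by
  rw [abs_div, abs_mul, abs_of_nonneg (sqrt_nonneg _), div_eq_mul_one_div]
  refine mul_le_mul_of_nonneg_right ?_ (by positivity)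
  linarith [abs_sub (e u) (e x), hM u hu, hM x hx]

theorem tendsto_principalValue (hx : x ∈ Set.Ioo (-1 : ℝ) 1)
    (hL : ∀ u ∈ Set.Icc (-1 : ℝ) 1, ∀ v ∈ Set.Icc (-1 : ℝ) 1, |e u - e v| ≤ L * |u - v|) :
    Tendsto (fun ε : ℝ => (∫ u in (-1 : ℝ)..(x - ε), e u / (√(1 - u ^ 2) * (u - x))) +
        ∫ u in (x + ε)..(1 : ℝ), e u / (√(1 - u ^ 2) * (u - x)))
      (𝓝[>] 0) (𝓝 (∫ u in (-1 : ℝ)..1, (e u - e x) / (√(1 - u ^ 2) * (u - x)))) := by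
  have hxI := Set.Ioo_subset_Icc_self hx
  set q : ℝ → ℝ := fun u => (e u - e x) / (√(1 - u ^ 2) * (u - x)) with hq
  have hqi : ∀ a b, -1 ≤ a → a ≤ b → b ≤ 1 → IntervalIntegrable q volume a b :=
    fun a b ha hab hb => intervalIntegrable_of_abs_le_inv_sqrt ha hab hb
      (aestronglyMeasurable_diffQuot hL) fun u hu =>
        abs_diffQuot_le_of_lipschitz hxI hL ⟨ha.trans hu.1, hu.2.trans hb⟩
  have hs : 0 < √(1 - x ^ 2) := sqrt_pos.2 (by nlinarith [hx.1, hx.2])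
  have hprim : ContinuousAt (fun b => ∫ u in (-1 : ℝ)..b, q u) x := by
    have := intervalIntegral.continuousOn_primitive_interval' (hqi (-1) 1 le_rfl (by norm_num) le_rfl)
      (a := -1) Set.left_mem_uIcc
    rw [Set.uIcc_of_le (by norm_num)] at this
    exact this.continuousAt (Icc_mem_nhds hx.1 hx.2)
  have hsub : Tendsto (fun ε : ℝ => x - ε) (𝓝 0) (𝓝 x) := by
    simpa using (tendsto_const_nhds (x := x)).sub (tendsto_id (x := 𝓝 (0 : ℝ)))
  have hadd : Tendsto (fun ε : ℝ => x + ε) (𝓝 0) (𝓝 x) := by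
    simpa using (tendsto_const_nhds (x := x)).add (tendsto_id (x := 𝓝 (0 : ℝ)))
  have hlim : Tendsto (fun ε : ℝ => (∫ u in (-1 : ℝ)..1, q u) +
      (((∫ u in (-1 : ℝ)..(x - ε), q u) - ∫ u in (-1 : ℝ)..(x + ε), q u) +
      e x / √(1 - x ^ 2) * (cauchyPrimitive x (x - ε) - cauchyPrimitive x (x + ε))))
      (𝓝[>] 0) (𝓝 (∫ u in (-1 : ℝ)..1, q u)) := by
    have := tendsto_const_nhds (x := ∫ u in (-1 : ℝ)..1, q u) |>.add
      (((hprim.tendsto.comp hsub).sub (hprim.tendsto.comp hadd)).add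
        ((tendsto_cauchyPrimitive_sub hx).const_mul (e x / √(1 - x ^ 2))))
    simp only [sub_self, mul_zero, add_zero] at this
    exact this.mono_left nhdsWithin_le_nhds
  refine hlim.congr' ?_
  have hδ : 0 < min (1 + x) (1 - x) := lt_min (by linarith [hx.1]) (by linarith [hx.2])
  filter_upwards [Ioo_mem_nhdsGT hδ] with ε hε
  have hε0 := hε.1
  have hε1 : ε < 1 + x := hε.2.trans_le (min_le_left _ _)
  have hε2 : ε < 1 - x := hε.2.trans_le (min_le_right _ _)
  have hsplit : ∀ a b, -1 ≤ a → a ≤ b → b ≤ 1 → x ∉ Set.Icc a b →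
      ∫ u in a..b, e u / (√(1 - u ^ 2) * (u - x)) = (∫ u in a..b, q u) +
        e x / √(1 - x ^ 2) * (cauchyPrimitive x b - cauchyPrimitive x a) := by
    intro a b ha hab hb hxab
    rw [← integral_cauchyKernel hx ha hab hb hxab, ← mul_assoc, div_mul_cancel₀ _ hs.ne',
      ← intervalIntegral.integral_const_mul, ← intervalIntegral.integral_add (hqi a b ha hab hb)
        ((intervalIntegrable_cauchyKernel ha hab hb hxab).const_mul _)]
    refine intervalIntegral.integral_congr fun u _ => ?_
    simp only [hq]
    ring
  rw [hsplit (-1) (x - ε) le_rfl (by linarith) (by linarith) fun h => by linarith [h.2],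
    hsplit (x + ε) 1 (by linarith) (by linarith) le_rfl fun h => by linarith [h.1],
    cauchyPrimitive_neg_one, cauchyPrimitive_one,
    ← intervalIntegral.integral_add_adjacent_intervals
      (hqi (-1) (x + ε) le_rfl (by linarith) (by linarith))
      (hqi (x + ε) 1 (by linarith) (by linarith) le_rfl)]
  ring

theorem abs_principalValue_le {N : ℕ} (hN : 1 ≤ N) (hx : x ∈ Set.Ioo (-1 : ℝ) 1)
    (hM : ∀ u ∈ Set.Icc (-1 : ℝ) 1, |e u| ≤ M)
    (hL : ∀ u ∈ Set.Icc (-1 : ℝ) 1, ∀ v ∈ Set.Icc (-1 : ℝ) 1, |e u - e v| ≤ L * |u - v|) :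
    √(1 - x ^ 2) * |∫ u in (-1 : ℝ)..1, (e u - e x) / (√(1 - u ^ 2) * (u - x))| ≤
      4 * M * log N + 2 * π * L / N := by
  have hxI := Set.Ioo_subset_Icc_self hx
  have hL0 : 0 ≤ L := by
    have := (abs_nonneg _).trans (hL 1 (by norm_num) 0 (by norm_num))
    simpa using this
  have hM0 : 0 ≤ M := (abs_nonneg _).trans (hM x hxI)
  have hs0 : 0 ≤ √(1 - x ^ 2) := sqrt_nonneg _
  have hs1 : √(1 - x ^ 2) ≤ 1 := sqrt_le_one.2 (by nlinarith)
  obtain ⟨a, ha, hax, hDa, hasin⟩ := exists_cut_left hN hx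
  obtain ⟨b, hxb, hb, hDb, hbsin⟩ := exists_cut_right hN hx
  set q : ℝ → ℝ := fun u => (e u - e x) / (√(1 - u ^ 2) * (u - x)) with hq
  have hqi : ∀ a b, -1 ≤ a → a ≤ b → b ≤ 1 → IntervalIntegrable q volume a b :=
    fun a b ha hab hb => intervalIntegrable_of_abs_le_inv_sqrt ha hab hb
      (aestronglyMeasurable_diffQuot hL) fun u hu =>
        abs_diffQuot_le_of_lipschitz hxI hL ⟨ha.trans hu.1, hu.2.trans hb⟩
  have hfar : ∀ c d σ, -1 ≤ c → c ≤ d → d ≤ 1 → x ∉ Set.Icc c d →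
      (∀ u ∈ Set.Icc c d, |u - x| = σ * (u - x)) → (σ = 1 ∨ σ = -1) →
      √(1 - x ^ 2) * |∫ u in c..d, q u| ≤
        2 * M * (σ * (cauchyPrimitive x d - cauchyPrimitive x c)) := by
    intro c d σ hc hcd hd hxcd hσ hσ1
    rw [← integral_cauchyKernel hx hc hcd hd hxcd]
    have hσ2 : 1 / σ = σ := by rcases hσ1 with rfl | rfl <;> norm_num
    have h1 : |∫ u in c..d, q u| ≤
        ∫ u in c..d, 2 * M * σ * (1 / (√(1 - u ^ 2) * (u - x))) := by
      rw [← Real.norm_eq_abs]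
      refine intervalIntegral.norm_integral_le_of_norm_le hcd (ae_of_all _ fun u hu => ?_)
        ((intervalIntegrable_cauchyKernel hc hcd hd hxcd).const_mul _)
      have hu' := Set.Ioc_subset_Icc_self hu
      refine (abs_diffQuot_le_of_bound hxI hM ⟨hc.trans hu'.1, hu'.2.trans hd⟩).trans_eq ?_
      rw [hσ u hu', mul_left_comm, ← one_div_mul_one_div, hσ2]
      ring
    rw [intervalIntegral.integral_const_mul] at h1
    refine (mul_le_mul_of_nonneg_left h1 hs0).trans_eq ?_
    ring
  have hleft : √(1 - x ^ 2) * |∫ u in (-1 : ℝ)..a, q u| ≤ 2 * M * log N := by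
    refine (hfar (-1) a (-1) le_rfl ha (by linarith [hx.2]) (fun h => by linarith [h.2])
      (fun u hu => by rw [abs_of_neg (by linarith [hu.2])]; ring) (Or.inr rfl)).trans ?_
    refine mul_le_mul_of_nonneg_left ?_ (by positivity)
    have := neg_cauchyPrimitive_le hx ⟨ha, by linarith [hx.2]⟩ hax.ne (c := N)
      (by rwa [abs_sub_comm, abs_of_pos (by linarith)])
    rw [cauchyPrimitive_neg_one]
    linarith
  have hright : √(1 - x ^ 2) * |∫ u in b..1, q u| ≤ 2 * M * log N := by
    refine (hfar b 1 1 (by linarith [hx.1]) hb le_rfl (fun h => by linarith [h.1])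
      (fun u hu => by rw [abs_of_pos (by linarith [hu.1])]; ring) (Or.inl rfl)).trans ?_
    refine mul_le_mul_of_nonneg_left ?_ (by positivity)
    have := neg_cauchyPrimitive_le hx ⟨by linarith [hx.1], hb⟩ hxb.ne' (c := N)
      (by rwa [abs_of_pos (by linarith)])
    rw [cauchyPrimitive_one]
    linarith
  have hnear : √(1 - x ^ 2) * |∫ u in a..b, q u| ≤ 2 * π * L / N := by
    have hab : a ≤ b := by linarith
    have hint : IntervalIntegrable (fun u : ℝ => 1 / √(1 - u ^ 2)) volume a b := by
      refine intervalIntegrable_inv_sqrt_one_sub_sq.mono_set ?_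
      rw [Set.uIcc_of_le hab, Set.uIcc_of_le (by norm_num)]
      exact Set.Icc_subset_Icc ha hb
    have h1 : |∫ u in a..b, q u| ≤ ∫ u in a..b, L * (1 / √(1 - u ^ 2)) := by
      rw [← Real.norm_eq_abs]
      exact intervalIntegral.norm_integral_le_of_norm_le hab (ae_of_all _ fun u hu =>
        abs_diffQuot_le_of_lipschitz hxI hL ⟨ha.trans hu.1.le, hu.2.trans hb⟩) (hint.const_mul _)
    rw [intervalIntegral.integral_const_mul,
      intervalIntegral.integral_eq_sub_of_hasDerivAt_of_le hab continuous_arcsin.continuousOn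
        (fun u hu => hasDerivAt_arcsin (ha.trans_lt hu.1).ne' (hu.2.trans_le hb).ne) hint] at h1
    calc √(1 - x ^ 2) * |∫ u in a..b, q u| ≤ 1 * |∫ u in a..b, q u| :=
          mul_le_mul_of_nonneg_right hs1 (abs_nonneg _)
      _ ≤ L * (π / N + π / N) := by
          rw [one_mul]
          exact h1.trans (mul_le_mul_of_nonneg_left (by linarith) hL0)
      _ = 2 * π * L / N := by ring
  rw [← intervalIntegral.integral_add_adjacent_intervals (hqi (-1) b le_rfl (by linarith) hb)
      (hqi b 1 (by linarith) hb le_rfl),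
    ← intervalIntegral.integral_add_adjacent_intervals (hqi (-1) a le_rfl ha (by linarith))
      (hqi a b ha (by linarith) hb)]
  have := mul_le_mul_of_nonneg_left
    (abs_add_three (∫ u in (-1 : ℝ)..a, q u) (∫ u in a..b, q u) (∫ u in b..1, q u)) hs0
  rw [mul_add, mul_add] at this
  linarith

end PrincipalValue

theorem quadrature_error_CC1alpha_table3
    (N : ℕ) (hN : 3 ≤ N)
    (t : ℕ → ℝ) (ht0 : t 0 = -1) (htN : t N = 1)
    (hmono : ∀ k, k < N → t k < t (k + 1))
    (γ : ℝ) (hγ : 0 < γ)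
    (hstep : ∀ k, k < N → t (k + 1) - t k ≤ γ / N)
    (f S : ℝ → ℝ) (K₁ α : ℝ) (hα : 0 < α) (hα1 : α ≤ 1)
    (hfc : ContinuousOn f (Set.Icc (-1 : ℝ) 1))
    (hf : ∀ k, k < N → ∃ g : ℝ → ℝ,
      (∀ u ∈ Set.Icc (t k) (t (k + 1)),
        HasDerivWithinAt f (g u) (Set.Icc (t k) (t (k + 1))) u) ∧
      (∀ u ∈ Set.Icc (t k) (t (k + 1)), ∀ v ∈ Set.Icc (t k) (t (k + 1)),
        |g u - g v| ≤ K₁ * |u - v| ^ α))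
    (hS : ∀ k, k < N → ∀ u ∈ Set.Icc (t k) (t (k + 1)),
      S u = ((t (k + 1) - u) * f (t k) + (u - t k) * f (t (k + 1))) / (t (k + 1) - t k))
    (x : ℝ) (hx : x ∈ Set.Ioo (-1 : ℝ) 1) :
    ∃ I : ℝ,
      Tendsto (fun ε : ℝ =>
          (∫ u in (-1 : ℝ)..(x - ε), (f u - S u) / (Real.sqrt (1 - u ^ 2) * (u - x))) +
          ∫ u in (x + ε)..(1 : ℝ), (f u - S u) / (Real.sqrt (1 - u ^ 2) * (u - x)))
        (𝓝[>] (0 : ℝ)) (𝓝 I) ∧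
      |Real.sqrt (1 - x ^ 2) / π * I| ≤
        (γ ^ (1 + α) * K₁ / π) * (1 + 12 * π / (γ * Real.log N)) *
          Real.log N / (N : ℝ) ^ (1 + α) := by
  have hN0 : (0 : ℝ) < N := by exact_mod_cast (by omega : 0 < N)
  have hlog : 0 < log N := log_pos (by exact_mod_cast (by omega : 1 < N))
  set H : ℝ := γ / N with hH
  have hH0 : 0 < H := div_pos hγ hN0
  have hK : 0 ≤ K₁ := by
    obtain ⟨g, -, hg⟩ := hf 0 (by omega)
    have hlt := hmono 0 (by omega)
    have := (abs_nonneg _).trans (hg _ (Set.left_mem_Icc.2 hlt.le) _ (Set.right_mem_Icc.2 hlt.le))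
    exact nonneg_of_mul_nonneg_left this
      (rpow_pos_of_pos (abs_pos.2 (sub_ne_zero.2 hlt.ne)) _)
  have hosc : ∀ k, k < N → ∃ g : ℝ → ℝ,
      (∀ u ∈ Set.Icc (t k) (t (k + 1)),
        HasDerivWithinAt f (g u) (Set.Icc (t k) (t (k + 1))) u) ∧
      (∀ u ∈ Set.Icc (t k) (t (k + 1)), ∀ v ∈ Set.Icc (t k) (t (k + 1)),
        |g u - g v| ≤ K₁ * H ^ α) := by
    intro k hk
    obtain ⟨g, hg, hg'⟩ := hf k hk
    refine ⟨g, hg, fun u hu v hv => (hg' u hu v hv).trans ?_⟩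
    refine mul_le_mul_of_nonneg_left (rpow_le_rpow (abs_nonneg _) ?_ hα.le) hK
    have := hstep k hk
    exact abs_le.2 ⟨by linarith [hu.1, hv.2], by linarith [hu.2, hv.1]⟩
  have hC : 0 ≤ K₁ * H ^ α := mul_nonneg hK (rpow_nonneg hH0.le _)
  have hL : ∀ u ∈ Set.Icc (-1 : ℝ) 1, ∀ v ∈ Set.Icc (-1 : ℝ) 1,
      |(f u - S u) - (f v - S v)| ≤ K₁ * H ^ α * |u - v| := by
    rw [← ht0, ← htN]
    refine abs_sub_le_of_abs_sub_le_on_grid (e := fun u => f u - S u) hmono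
      fun k hk u hu v hv => ?_
    obtain ⟨g, hg, hg'⟩ := hosc k hk
    simp only [hS k hk u hu, hS k hk v hv]
    exact abs_sub_linear_interpolation_sub_le (hmono k hk) hg hg' hu hv
  have hM : ∀ u ∈ Set.Icc (-1 : ℝ) 1, |f u - S u| ≤ K₁ * H ^ α * H / 4 := by
    rw [← ht0, ← htN]
    intro u hu
    obtain ⟨k, hk, huk⟩ := exists_mem_Icc_grid (by omega) hu
    obtain ⟨g, hg, hg'⟩ := hosc k hk
    rw [hS k hk u huk]
    refine (abs_sub_linear_interpolation_le (hmono k hk) hg hg' huk).trans ?_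
    have := mul_le_mul_of_nonneg_left (hstep k hk) hC
    linarith
  refine ⟨_, tendsto_principalValue (e := fun u => f u - S u) hx hL, ?_⟩
  have hbound := abs_principalValue_le (e := fun u => f u - S u) (by omega : 1 ≤ N) hx hM hL
  have hrhs : γ ^ (1 + α) * K₁ / π * (1 + 12 * π / (γ * log N)) * log N / (N : ℝ) ^ (1 + α) =
      (K₁ * H ^ α * H * log N + 12 * π * (K₁ * H ^ α) / N) / π := by
    have h1 : γ ^ (1 + α) = γ * γ ^ α := by rw [rpow_add hγ, rpow_one]
    have h2 : (N : ℝ) ^ (1 + α) = N * (N : ℝ) ^ α := by rw [rpow_add hN0, rpow_one]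
    have h3 : H ^ α = γ ^ α / (N : ℝ) ^ α := div_rpow hγ.le hN0.le _
    have h4 : (N : ℝ) ^ α ≠ 0 := (rpow_pos_of_pos hN0 _).ne'
    rw [h1, h2, h3, hH]
    field_simp
  rw [hrhs, abs_mul, abs_of_nonneg (div_nonneg (sqrt_nonneg _) pi_pos.le), div_mul_eq_mul_div]
  refine div_le_div_of_nonneg_right (hbound.trans ?_) pi_pos.le
  have : 2 * π * (K₁ * H ^ α) / N ≤ 12 * π * (K₁ * H ^ α) / N := by
    gcongr
    norm_num
  linarith
end

section
/- Let 0 < σ ≤ 1, 0 < ε < 1/2, and let x be a real number with 0 ≤ x and ε ≤ 1 − x. Then T(x,ε,σ) = √(1−x²)·∫_{x−ε}^{x+ε} |t−x|^{σ−1}/√(1−t²) dt satisfies T(x,ε,σ) ≤ 2^{1−σ}·(2 + 1/σ)·ε^σ. -/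
open Real MeasureTheory Filter Topology

/-- Weighted arithmetic–geometric mean bound for `v ^ (σ - 1)` times the excess of
`1 / √(1 - v)` over `1`. -/
lemma rpow_sub_one_div_sqrt_one_sub_le {σ v : ℝ} (hσ : 0 ≤ σ) (hσ1 : σ ≤ 1)
    (hv : 0 < v) (hv1 : v < 1) :
    v ^ (σ - 1) * (1 / √(1 - v)) ≤ v ^ (σ - 1) + 1 / √(1 - v) - (1 + σ) / 2 := by
  have hamgm : v ^ (σ - 1) ≤ (1 - σ) * v⁻¹ + σ := by
    have h := Real.geom_mean_le_arith_mean2_weighted (w₁ := 1 - σ) (w₂ := σ) (p₁ := v⁻¹) (p₂ := 1)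
      (by linarith) hσ (by positivity) zero_le_one (by ring)
    rw [Real.one_rpow, mul_one, mul_one, Real.inv_rpow hv.le, ← Real.rpow_neg hv.le] at h
    rwa [show σ - 1 = -(1 - σ) by ring]
  obtain ⟨r, hr⟩ : ∃ r, r = √(1 - v) := ⟨_, rfl⟩
  have hr0 : 0 < r := hr ▸ Real.sqrt_pos.2 (by linarith)
  have hr2 : v = 1 - r ^ 2 := by rw [hr, Real.sq_sqrt (by linarith)]; ring
  have hr1 : r < 1 := by nlinarith
  rw [← hr]
  have hexcess : 0 ≤ 1 / r - 1 := by
    rw [sub_nonneg, le_div_iff₀ hr0]; linarith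
  have hchord : v⁻¹ * (1 / r - 1) ≤ 1 / r - 1 / 2 := by
    have : v⁻¹ * (1 / r - 1) = 1 / (r * (1 + r)) := by
      have h1 : 1 - r ≠ 0 := by linarith
      have h2 : 1 + r ≠ 0 := by linarith
      rw [hr2, show 1 - r ^ 2 = (1 - r) * (1 + r) by ring]
      field_simp
    rw [this, div_le_iff₀ (by positivity)]
    have : (1 / r - 1 / 2) * (r * (1 + r)) = (1 - r / 2) * (1 + r) := by field_simp
    rw [this]
    nlinarith
  nlinarith [mul_le_mul_of_nonneg_right hamgm hexcess,
    mul_le_mul_of_nonneg_left hchord (sub_nonneg.2 hσ1)]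

lemma sqrt_div_le_one_add {a b c : ℝ} (hb : 0 < b) (hc : 0 ≤ c) (h : a ≤ (1 + 2 * c) * b) :
    √a / √b ≤ 1 + c := by
  rw [div_le_iff₀ (Real.sqrt_pos.2 hb)]
  apply Real.sqrt_le_iff.2 ⟨by positivity, ?_⟩
  rw [mul_pow, Real.sq_sqrt hb.le]
  nlinarith [mul_nonneg (sq_nonneg c) hb.le]

/-- The combined weight at two points symmetric about `x`. -/
lemma sqrt_one_sub_sq_ratio_add_le {ε x v : ℝ} (hε : 0 < ε) (hε2 : ε < 1 / 2)
    (hx : 0 ≤ x) (hxε : ε ≤ 1 - x) (hv : 0 < v) (hv1 : v < 1) :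
    √(1 - x ^ 2) / √(1 - (x + ε * v) ^ 2) + √(1 - x ^ 2) / √(1 - (x - ε * v) ^ 2)
      ≤ 1 + 1 / √(1 - v) := by
  obtain ⟨s, hs⟩ : ∃ s, s = ε * v := ⟨_, rfl⟩
  rw [← hs]
  have hs0 : 0 < s := hs ▸ mul_pos hε hv
  have hsε : s < ε := by rw [hs]; nlinarith
  rcases le_or_gt s (2 * x) with hsx | hsx
  · have h1 : √(1 - x ^ 2) / √(1 - (x + s) ^ 2) ≤ 1 / √(1 - v) := by
      rw [div_le_div_iff₀ (Real.sqrt_pos.2 (by nlinarith)) (Real.sqrt_pos.2 (by linarith)),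
        one_mul, ← Real.sqrt_mul (by nlinarith)]
      apply Real.sqrt_le_sqrt
      have h2 : (1 - x) * (1 - v) ≤ 1 - (x + s) := by nlinarith
      have h3 : (1 - x) * (1 - v) * (1 + x) ≤ (1 - (x + s)) * (1 + x + s) :=
        mul_le_mul h2 (by linarith) (by linarith) (by linarith)
      linarith
    have h2 : √(1 - x ^ 2) / √(1 - (x - s) ^ 2) ≤ 1 := by
      apply div_le_one_of_le₀ _ (Real.sqrt_nonneg _)
      apply Real.sqrt_le_sqrt
      nlinarith
    linarith
  · have hs2 : s < 1 / 2 := by linarith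
    have h1 : √(1 - x ^ 2) / √(1 - (x + s) ^ 2) ≤ 1 + 16 / 7 * s ^ 2 := by
      have hb : 7 / 16 ≤ 1 - (x + s) ^ 2 := by nlinarith
      apply sqrt_div_le_one_add (by linarith) (by positivity)
      nlinarith [mul_le_mul_of_nonneg_left hb (sq_nonneg s)]
    have h2 : √(1 - x ^ 2) / √(1 - (x - s) ^ 2) ≤ 1 + 2 / 3 * s ^ 2 := by
      have hb : 3 / 4 ≤ 1 - (x - s) ^ 2 := by nlinarith
      apply sqrt_div_le_one_add (by linarith) (by positivity)
      nlinarith [mul_le_mul_of_nonneg_left hb (sq_nonneg s)]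
    have h3 : 1 + s + 3 / 2 * s ^ 2 ≤ 1 / √(1 - v) := by
      have hv0 : 0 < 1 - v := by linarith
      have hvs : 1 - v ≤ 1 - 2 * s := by rw [hs]; nlinarith
      rw [le_div_iff₀ (Real.sqrt_pos.2 hv0), ← Real.sqrt_sq (show 0 ≤ 1 + s + 3 / 2 * s ^ 2 by
        positivity), ← Real.sqrt_mul (sq_nonneg _)]
      apply Real.sqrt_le_one.2
      calc (1 + s + 3 / 2 * s ^ 2) ^ 2 * (1 - v)
          ≤ (1 + s + 3 / 2 * s ^ 2) ^ 2 * (1 - 2 * s) := by gcongr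
        _ = 1 - (5 * s ^ 3 + 15 / 4 * s ^ 4 + 9 / 2 * s ^ 5) := by ring
        _ ≤ 1 := by
          have : 0 ≤ 5 * s ^ 3 + 15 / 4 * s ^ 4 + 9 / 2 * s ^ 5 := by positivity
          linarith
    nlinarith

lemma two_div_add_le_two_rpow {σ : ℝ} (hσ : 0 < σ) (hσ1 : σ ≤ 1) :
    2 / σ + (3 - σ) / 2 ≤ 2 ^ (1 - σ) * (2 + 1 / σ) := by
  have hexp (t : ℝ) : 1 + Real.log 2 * t ≤ 2 ^ t := by
    rw [Real.rpow_def_of_pos two_pos]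
    linarith [Real.add_one_le_exp (Real.log 2 * t)]
  have hL := Real.log_two_gt_d9
  have hL' := Real.log_two_lt_d9
  have key : 4 + 3 * σ - σ ^ 2 ≤ 2 * 2 ^ (1 - σ) * (2 * σ + 1) := by
    rcases le_total σ (2 / 5) with h | h
    · have h1 := hexp (-σ)
      have h2 : (2 : ℝ) ^ (1 - σ) = 2 * 2 ^ (-σ) := by
        rw [sub_eq_add_neg, Real.rpow_add two_pos, Real.rpow_one]
      rw [h2]
      have h3 : 0 ≤ σ * (5 - 4 * Real.log 2 - 8 * Real.log 2 * σ + σ) :=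
        mul_nonneg hσ.le (by nlinarith)
      nlinarith [mul_le_mul_of_nonneg_right h1 (show 0 ≤ 2 * σ + 1 by linarith)]
    · have h1 := hexp (1 - σ)
      have h3 : 0 ≤ (1 - σ) * (6 * Real.log 2 - 3 - (4 * Real.log 2 - 1) * (1 - σ)) :=
        mul_nonneg (by linarith) (by nlinarith)
      nlinarith [mul_le_mul_of_nonneg_right h1 (show 0 ≤ 2 * σ + 1 by linarith)]
  have e1 : 2 / σ + (3 - σ) / 2 = (4 + 3 * σ - σ ^ 2) / (2 * σ) := by field_simp; ring
  have e2 : 2 ^ (1 - σ) * (2 + 1 / σ) = (2 * 2 ^ (1 - σ) * (2 * σ + 1)) / (2 * σ) := by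
    field_simp
  rw [e1, e2]
  gcongr

lemma one_div_sqrt_eq_rpow (w : ℝ) (hw : 0 ≤ w) : 1 / √w = w ^ (-(1 / 2) : ℝ) := by
  rw [Real.rpow_neg hw, Real.sqrt_eq_rpow, one_div]

theorem T_integral_bound
    (σ ε x : ℝ) (hσ : 0 < σ) (hσ1 : σ ≤ 1) (hε : 0 < ε) (hε2 : ε < 1 / 2)
    (hx : 0 ≤ x) (hxε : ε ≤ 1 - x) :
    Real.sqrt (1 - x ^ 2) *
        ∫ u in (x - ε)..(x + ε), |u - x| ^ (σ - 1) / Real.sqrt (1 - u ^ 2) ≤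
      2 ^ (1 - σ) * (2 + 1 / σ) * ε ^ σ := by
  set F : ℝ → ℝ := fun u => |u - x| ^ (σ - 1) / √(1 - u ^ 2) with hF
  by_cases hint : IntervalIntegrable F volume (x - ε) (x + ε)
  swap
  · rw [intervalIntegral.integral_undef hint, mul_zero]
    positivity
  have hl : IntervalIntegrable F volume (x - ε) x := hint.mono_set (by
    rw [Set.uIcc_of_le (by linarith), Set.uIcc_of_le (by linarith)]
    exact Set.Icc_subset_Icc le_rfl (by linarith))
  have hr : IntervalIntegrable F volume x (x + ε) := hint.mono_set (by
    rw [Set.uIcc_of_le (by linarith), Set.uIcc_of_le (by linarith)]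
    exact Set.Icc_subset_Icc (by linarith) le_rfl)
  have hr' : IntervalIntegrable (fun v => F (x + ε * v)) volume 0 1 := by
    have := (hr.comp_add_left x).comp_mul_left (c := ε)
    simpa [hε.ne'] using this
  have hl' : IntervalIntegrable (fun v => F (x - ε * v)) volume 0 1 := by
    have := ((hl.comp_sub_left x).comp_mul_left (c := ε)).symm
    simpa [hε.ne'] using this
  have hsplit : ∫ u in (x - ε)..(x + ε), F u
      = ε * ∫ v in (0 : ℝ)..1, (F (x + ε * v) + F (x - ε * v)) := by
    rw [intervalIntegral.integral_add hr' hl', intervalIntegral.integral_comp_add_mul F hε.ne',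
      intervalIntegral.integral_comp_sub_mul F hε.ne',
      ← intervalIntegral.integral_add_adjacent_intervals hl hr]
    simp only [mul_zero, mul_one, add_zero, sub_zero, smul_eq_mul]
    field_simp
    ring
  set H : ℝ → ℝ := fun v => 2 * v ^ (σ - 1) + (1 - v) ^ (-(1 / 2) : ℝ) - (1 + σ) / 2 with hH
  have hi1 : IntervalIntegrable (fun v : ℝ => 2 * v ^ (σ - 1)) volume 0 1 :=
    (intervalIntegral.intervalIntegrable_rpow' (by linarith)).const_mul 2
  have hi2 : IntervalIntegrable (fun v : ℝ => (1 - v) ^ (-(1 / 2) : ℝ)) volume 0 1 := by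
    have := (intervalIntegral.intervalIntegrable_rpow' (a := 0) (b := 1) (r := -(1 / 2))
      (by norm_num)).comp_sub_left 1
    simpa using this.symm
  have hHi : IntervalIntegrable H volume 0 1 := (hi1.add hi2).sub intervalIntegrable_const
  have hHint : ∫ v in (0 : ℝ)..1, H v = 2 / σ + (3 - σ) / 2 := by
    rw [hH, intervalIntegral.integral_sub (hi1.add hi2) intervalIntegrable_const,
      intervalIntegral.integral_add hi1 hi2, intervalIntegral.integral_const_mul,
      integral_rpow (Or.inl (by linarith)),
      intervalIntegral.integral_comp_sub_left (fun w : ℝ => w ^ (-(1 / 2) : ℝ)) 1,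
      integral_rpow (Or.inl (by norm_num))]
    norm_num [Real.zero_rpow hσ.ne']
    ring
  have hpt : ∀ v ∈ Set.Ioo (0 : ℝ) 1,
      √(1 - x ^ 2) * (F (x + ε * v) + F (x - ε * v)) ≤ ε ^ (σ - 1) * H v := by
    rintro v ⟨hv, hv1⟩
    have hεv : 0 < ε * v := mul_pos hε hv
    have e1 : |x + ε * v - x| = ε * v := by rw [add_sub_cancel_left, abs_of_pos hεv]
    have e2 : |x - ε * v - x| = ε * v := by rw [sub_sub_cancel_left, abs_neg, abs_of_pos hεv]
    simp only [hF, hH, e1, e2]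
    rw [Real.mul_rpow hε.le hv.le, ← one_div_sqrt_eq_rpow _ (by linarith)]
    calc _ = ε ^ (σ - 1) * (v ^ (σ - 1) * (√(1 - x ^ 2) / √(1 - (x + ε * v) ^ 2)
            + √(1 - x ^ 2) / √(1 - (x - ε * v) ^ 2))) := by ring
      _ ≤ ε ^ (σ - 1) * (v ^ (σ - 1) * (1 + 1 / √(1 - v))) := by
        refine mul_le_mul_of_nonneg_left (mul_le_mul_of_nonneg_left ?_ (by positivity))
          (by positivity)
        exact sqrt_one_sub_sq_ratio_add_le hε hε2 hx hxε hv hv1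
      _ ≤ _ := by
        gcongr
        linarith [rpow_sub_one_div_sqrt_one_sub_le hσ.le hσ1 hv hv1]
  have hmono := intervalIntegral.integral_mono_on_of_le_Ioo zero_le_one
    ((hr'.add hl').const_mul √(1 - x ^ 2)) (hHi.const_mul (ε ^ (σ - 1))) hpt
  rw [intervalIntegral.integral_const_mul, intervalIntegral.integral_const_mul, hHint] at hmono
  calc _ = ε * (√(1 - x ^ 2) * ∫ v in (0 : ℝ)..1, (F (x + ε * v) + F (x - ε * v))) := by
        rw [hsplit]; ring
    _ ≤ ε * (ε ^ (σ - 1) * (2 / σ + (3 - σ) / 2)) := by gcongr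
    _ = (2 / σ + (3 - σ) / 2) * ε ^ σ := by
        rw [Real.rpow_sub_one hε.ne']; field_simp
    _ ≤ _ := by
        gcongr
        exact two_div_add_le_two_rpow hσ hσ1
end
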